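/- arXiv:1608.02681 — 4 statements merged into one kernel-verified Lean document; each statement's English description precedes it below -/
import Mathlib

section
/- Let F be a traditional logic program and p a tuple of predicate symbols. Then the def-modules SM_p[F] and SM_p[shift_p(F)] are equivalent (have the same models), where shift_p(F) is obtained from F by applying to each rule R of the form ∀̃(B → a₁ ∨ … ∨ a_k) the transformation shift_p(R) = the universal closure of (B ∧ ⋀_{π(a_i)∉p, 1≤i≤k} ¬a_i) → ⋁_{π(a_i)∈p, 1≤i≤k} a_i, i.e., every atomic formula in the head whose predicate symbol is not in p is moved to the body preceded by negation. -/
namespace ASP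

/-- A first-order signature: predicate symbols and function symbols with arities.
A function symbol of arity 0 is an object constant. -/
structure Signature where
  PredSym : Type
  FunSym : Type
  predArity : PredSym → ℕ
  funArity : FunSym → ℕ

variable {σ : Signature}

/-- First-order terms over a signature, with variables indexed by natural numbers. -/
inductive Term (σ : Signature) : Type
  | var : ℕ → Term σ
  | fn : (f : σ.FunSym) → (Fin (σ.funArity f) → Term σ) → Term σ

/-- Function symbols occurring in a term. -/
def Term.funs : Term σ → Set σ.FunSym
  | .var _ => ∅
  | .fn f a => insert f (⋃ i, (a i).funs)

/-- Variables occurring in a term. -/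
def Term.fv : Term σ → Set ℕ
  | .var n => {n}
  | .fn _ a => ⋃ i, (a i).fv

/-- First-order formulas (with equality) over a signature. -/
inductive Formula (σ : Signature) : Type
  | falsum
  | pred (p : σ.PredSym) (args : Fin (σ.predArity p) → Term σ)
  | eq (t u : Term σ)
  | and (F G : Formula σ)
  | or (F G : Formula σ)
  | imp (F G : Formula σ)
  | all (x : ℕ) (F : Formula σ)
  | ex (x : ℕ) (F : Formula σ)

/-- `¬F` abbreviates `F → ⊥`. -/
def Formula.neg (F : Formula σ) : Formula σ := .imp F .falsum

/-- `⊤` abbreviates `⊥ → ⊥`. -/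
def Formula.top : Formula σ := .imp .falsum .falsum

/-- Predicate symbols occurring in a formula (equality is not a predicate symbol). -/
def Formula.preds : Formula σ → Set σ.PredSym
  | .falsum => ∅
  | .pred p _ => {p}
  | .eq _ _ => ∅
  | .and F G => F.preds ∪ G.preds
  | .or F G => F.preds ∪ G.preds
  | .imp F G => F.preds ∪ G.preds
  | .all _ F => F.preds
  | .ex _ F => F.preds

/-- Function symbols occurring in a formula. -/
def Formula.funs : Formula σ → Set σ.FunSym
  | .falsum => ∅
  | .pred _ a => ⋃ i, (a i).funs
  | .eq t u => t.funs ∪ u.funs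
  | .and F G => F.funs ∪ G.funs
  | .or F G => F.funs ∪ G.funs
  | .imp F G => F.funs ∪ G.funs
  | .all _ F => F.funs
  | .ex _ F => F.funs

/-- A set of symbols of a signature (a "sub-signature"). -/
structure SymSet (σ : Signature) where
  preds : Set σ.PredSym
  funs : Set σ.FunSym

instance : Union (SymSet σ) := ⟨fun S T => ⟨S.preds ∪ T.preds, S.funs ∪ T.funs⟩⟩

/-- The signature `σ(F)` of a formula: all function and predicate symbols occurring
in it (equality excluded). -/
def Formula.syms (F : Formula σ) : SymSet σ := ⟨F.preds, F.funs⟩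

/-- An interpretation over the symbols in `S`: a nonempty universe, together with
interpretations of the function and predicate symbols; symbols outside `S` are given
fixed default values, so that an interpretation is determined by its values on `S`. -/
structure SInterp (σ : Signature) (S : SymSet σ) where
  U : Type
  ne : Nonempty U
  funI : (f : σ.FunSym) → (Fin (σ.funArity f) → U) → U
  predI : (p : σ.PredSym) → (Fin (σ.predArity p) → U) → Prop
  fun_default : ∀ f ∉ S.funs, ∀ a, funI f a = Classical.choice ne
  pred_default : ∀ p ∉ S.preds, ∀ a, predI p a = False

open Classical in
/-- The restriction `M|T` of an interpretation to the symbol set `T`. -/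
noncomputable def SInterp.restrict {S : SymSet σ} (M : SInterp σ S) (T : SymSet σ) :
    SInterp σ T where
  U := M.U
  ne := M.ne
  funI f a := if f ∈ T.funs then M.funI f a else Classical.choice M.ne
  predI p a := p ∈ T.preds ∧ M.predI p a
  fun_default := by intro f hf a; simp [hf]
  pred_default := by intro p hp a; simp [hp]

/-- Value of a term in an interpretation under a valuation. -/
def Term.eval {S : SymSet σ} (M : SInterp σ S) (v : ℕ → M.U) : Term σ → M.U
  | .var n => v n
  | .fn f a => M.funI f (fun i => (a i).eval M v)

/-- Tarskian satisfaction of a formula. -/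
def Sat {S : SymSet σ} (M : SInterp σ S) (v : ℕ → M.U) : Formula σ → Prop
  | .falsum => False
  | .pred p a => M.predI p (fun i => (a i).eval M v)
  | .eq t u => t.eval M v = u.eval M v
  | .and F G => Sat M v F ∧ Sat M v G
  | .or F G => Sat M v F ∨ Sat M v G
  | .imp F G => Sat M v F → Sat M v G
  | .all x F => ∀ d, Sat M (Function.update v x d) F
  | .ex x F => ∃ d, Sat M (Function.update v x d) F

/-- An assignment of relations to the predicate symbols (used for the tuple `u`
of predicate variables in the operator SM). -/
def PredAssign (σ : Signature) (U : Type) := (p : σ.PredSym) → (Fin (σ.predArity p) → U) → Prop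

/-- Satisfaction of `F^*(u)`, the Ferraris–Lee–Lifschitz transformation of `F`,
where `P` is the set of intensional predicates and `u` interprets the corresponding
predicate variables. -/
def SatStar {S : SymSet σ} (M : SInterp σ S) (u : PredAssign σ M.U) (P : Set σ.PredSym)
    (v : ℕ → M.U) : Formula σ → Prop
  | .falsum => False
  | .pred p a =>
      (p ∈ P ∧ u p (fun i => (a i).eval M v)) ∨ (p ∉ P ∧ M.predI p (fun i => (a i).eval M v))
  | .eq t s => t.eval M v = s.eval M v
  | .and F G => SatStar M u P v F ∧ SatStar M u P v G
  | .or F G => SatStar M u P v F ∨ SatStar M u P v G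
  | .imp F G => (SatStar M u P v F → SatStar M u P v G) ∧ (Sat M v F → Sat M v G)
  | .all x F => ∀ d, SatStar M u P (Function.update v x d) F
  | .ex x F => ∃ d, SatStar M u P (Function.update v x d) F

/-- `u < p`: the tuple `u` is pointwise contained in the intensional predicates `P`
of `M`, and not conversely. -/
def uLt {S : SymSet σ} (M : SInterp σ S) (P : Set σ.PredSym) (u : PredAssign σ M.U) : Prop :=
  (∀ p ∈ P, ∀ a, u p a → M.predI p a) ∧ ¬(∀ p ∈ P, ∀ a, M.predI p a → u p a)

/-- `M` is a `P`-stable model of the (first-order) formula `F`, i.e. `M` satisfies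
`SM_P[F] = F ∧ ¬∃u((u < P) ∧ F^*(u))` (formulas are read as their universal closures,
hence the quantification over valuations). -/
def Formula.PStable {S : SymSet σ} (P : Set σ.PredSym) (F : Formula σ) (M : SInterp σ S) : Prop :=
  (∀ v, Sat M v F) ∧ ¬∃ u : PredAssign σ M.U, uLt M P u ∧ ∀ v, SatStar M u P v F

/-- An atomic formula headed by a predicate symbol (no equality allowed). -/
def PAtom (σ : Signature) := Σ p : σ.PredSym, Fin (σ.predArity p) → Term σ

/-- An atomic formula: a predicate symbol applied to terms, or an equality. -/
inductive Atom (σ : Signature)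
  | pred (p : σ.PredSym) (args : Fin (σ.predArity p) → Term σ)
  | eq (t u : Term σ)

def PAtom.toFormula (a : PAtom σ) : Formula σ := .pred a.1 a.2

def Atom.toFormula : Atom σ → Formula σ
  | .pred p a => .pred p a
  | .eq t u => .eq t u

/-- A rule `a₁ ; … ; a_k ← a_{k+1}, …, a_l, not a_{l+1}, …, not a_m,
not not a_{m+1}, …, not not a_n`: the head atoms and the doubly negated atoms may
not contain equality. -/
structure Rule (σ : Signature) where
  head : List (PAtom σ)
  pos : List (Atom σ)
  neg : List (Atom σ)
  nneg : List (PAtom σ)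

def listAnd (l : List (Formula σ)) : Formula σ := l.foldr .and .top
def listOr (l : List (Formula σ)) : Formula σ := l.foldr .or .falsum

/-- The quantifier-free first-order implication corresponding to a rule
(its universal closure is taken by all semantic notions below). -/
def Rule.toOpen (R : Rule σ) : Formula σ :=
  .imp (listAnd (R.pos.map Atom.toFormula ++ R.neg.map (fun a => a.toFormula.neg) ++
          R.nneg.map (fun a => a.toFormula.neg.neg)))
       (listOr (R.head.map PAtom.toFormula))

/-- A traditional logic program: a finite set (list) of rules, viewed as the
conjunction of the universal closures of the corresponding implications. -/
abbrev Program (σ : Signature) := List (Rule σ)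

/-- `π(Π)`: predicate symbols occurring in a program. -/
def Program.preds (Pg : Program σ) : Set σ.PredSym := {p | ∃ R ∈ Pg, p ∈ R.toOpen.preds}

/-- Function symbols occurring in a program. -/
def Program.funs (Pg : Program σ) : Set σ.FunSym := {f | ∃ R ∈ Pg, f ∈ R.toOpen.funs}

/-- `σ(Π)`: the signature of a program. -/
def Program.syms (Pg : Program σ) : SymSet σ := ⟨Pg.preds, Pg.funs⟩

/-- `M` is a `P`-stable model of the program `Pg` viewed as a first-order formula
(the conjunction of the universal closures of its rules), i.e. `M ⊨ SM_P[Π]`. -/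
def Program.PStable {S : SymSet σ} (P : Set σ.PredSym) (Pg : Program σ) (M : SInterp σ S) : Prop :=
  (∀ R ∈ Pg, ∀ v, Sat M v R.toOpen) ∧
  ¬∃ u : PredAssign σ M.U, uLt M P u ∧ ∀ R ∈ Pg, ∀ v, SatStar M u P v R.toOpen


open Classical in
/-- `shift_p(R)`: every atomic formula in the head of `R` whose predicate symbol is
not in `p` is moved to the body of the rule, preceded by negation. -/
noncomputable def Rule.shift (p : Set σ.PredSym) (R : Rule σ) : Rule σ where
  head := R.head.filter (fun a => decide (a.1 ∈ p))
  pos := R.pos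
  neg := R.neg ++ (R.head.filter (fun a => decide (a.1 ∉ p))).map (fun a => Atom.pred a.1 a.2)
  nneg := R.nneg

/-- `shift_p(F)` for a traditional program: apply `shift_p` to each rule. -/
noncomputable def Program.shift (p : Set σ.PredSym) (Pg : Program σ) : Program σ :=
  Pg.map (Rule.shift p)

theorem sat_listAnd {S : SymSet σ} (M : SInterp σ S) (v : ℕ → M.U) (l : List (Formula σ)) :
    Sat M v (listAnd l) ↔ ∀ F ∈ l, Sat M v F := by
  induction l with
  | nil => simp [listAnd, Formula.top, Sat]
  | cons F l ih => simpa [listAnd, Sat] using fun _ => ih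

theorem sat_listOr {S : SymSet σ} (M : SInterp σ S) (v : ℕ → M.U) (l : List (Formula σ)) :
    Sat M v (listOr l) ↔ ∃ F ∈ l, Sat M v F := by
  induction l with
  | nil => simp [listOr, Sat]
  | cons F l ih => simpa [listOr, Sat] using or_congr_right ih

theorem satStar_listAnd {S : SymSet σ} (M : SInterp σ S) (u : PredAssign σ M.U)
    (P : Set σ.PredSym) (v : ℕ → M.U) (l : List (Formula σ)) :
    SatStar M u P v (listAnd l) ↔ ∀ F ∈ l, SatStar M u P v F := by
  induction l with
  | nil => simp [listAnd, Formula.top, SatStar, Sat]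
  | cons F l ih => simpa [listAnd, SatStar] using fun _ => ih

theorem satStar_listOr {S : SymSet σ} (M : SInterp σ S) (u : PredAssign σ M.U)
    (P : Set σ.PredSym) (v : ℕ → M.U) (l : List (Formula σ)) :
    SatStar M u P v (listOr l) ↔ ∃ F ∈ l, SatStar M u P v F := by
  induction l with
  | nil => simp [listOr, SatStar]
  | cons F l ih => simpa [listOr, SatStar] using or_congr_right ih

/-- Conjuncts indexed by the elements of `l` outside `p` may be moved from the premise of an
implication to the disjunction in its conclusion. -/
theorem shift_imp_iff {α : Type*} (l : List α) (B : Prop) (p A : α → Prop) :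
    (B → ∃ a ∈ l, A a) ↔ (B ∧ (∀ a ∈ l, ¬p a → ¬A a) → ∃ a ∈ l, p a ∧ A a) := by
  constructor
  · rintro h ⟨hB, hn⟩
    obtain ⟨a, ha, hA⟩ := h hB
    exact ⟨a, ha, by_contra fun hp => hn a ha (fun q => hp ⟨q, hA⟩) hA⟩
  · intro h hB
    by_contra hc
    obtain ⟨a, ha, -, hA⟩ := h ⟨hB, fun a ha _ hA => hc ⟨a, ha, hA⟩⟩
    exact hc ⟨a, ha, hA⟩

/-- The body of a rule. -/
def Rule.body (R : Rule σ) : List (Formula σ) :=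
  R.pos.map Atom.toFormula ++ R.neg.map (fun a => a.toFormula.neg) ++
    R.nneg.map (fun a => a.toFormula.neg.neg)

theorem Rule.mem_body_shift (p : Set σ.PredSym) (R : Rule σ) (F : Formula σ) :
    F ∈ (R.shift p).body ↔
      F ∈ R.body ∨ ∃ a ∈ R.head, a.1 ∉ p ∧ a.toFormula.neg = F := by
  simp only [Rule.body, Rule.shift, List.map_append, List.map_map, List.mem_append, List.mem_map,
    List.mem_filter, decide_eq_true_eq, Function.comp_apply, and_assoc]
  change ((_ ∨ _ ∨ ∃ a ∈ R.head, a.1 ∉ p ∧ a.toFormula.neg = F) ∨ _) ↔ _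
  rw [← or_assoc, or_right_comm]

theorem Rule.mem_head_shift (p : Set σ.PredSym) (R : Rule σ) (a : PAtom σ) :
    a ∈ (R.shift p).head ↔ a ∈ R.head ∧ a.1 ∈ p := by
  simp [Rule.shift]

theorem Rule.sat_toOpen {S : SymSet σ} (M : SInterp σ S) (v : ℕ → M.U) (R : Rule σ) :
    Sat M v R.toOpen ↔
      ((∀ F ∈ R.body, Sat M v F) → ∃ a ∈ R.head, Sat M v a.toFormula) := by
  change (Sat M v (listAnd R.body) → Sat M v (listOr _)) ↔ _
  simp [sat_listAnd, sat_listOr]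

theorem Rule.satStar_toOpen {S : SymSet σ} (M : SInterp σ S) (u : PredAssign σ M.U)
    (P : Set σ.PredSym) (v : ℕ → M.U) (R : Rule σ) :
    SatStar M u P v R.toOpen ↔
      ((∀ F ∈ R.body, SatStar M u P v F) → ∃ a ∈ R.head, SatStar M u P v a.toFormula) ∧
        Sat M v R.toOpen := by
  change ((SatStar M u P v (listAnd R.body) → SatStar M u P v (listOr _)) ∧ Sat M v R.toOpen) ↔ _
  simp [satStar_listAnd, satStar_listOr]

theorem PAtom.satStar_neg {S : SymSet σ} (M : SInterp σ S) (u : PredAssign σ M.U)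
    {P : Set σ.PredSym} (v : ℕ → M.U) {a : PAtom σ} (ha : a.1 ∉ P) :
    SatStar M u P v a.toFormula.neg ↔ ¬SatStar M u P v a.toFormula := by
  simp [PAtom.toFormula, Formula.neg, SatStar, Sat, ha]

theorem Rule.sat_shift {S : SymSet σ} (M : SInterp σ S) (p : Set σ.PredSym) (v : ℕ → M.U)
    (R : Rule σ) : Sat M v (R.shift p).toOpen ↔ Sat M v R.toOpen := by
  rw [Rule.sat_toOpen, Rule.sat_toOpen, shift_imp_iff _ (∀ F ∈ R.body, _) (fun a => a.1 ∈ p)]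
  have hbody : (∀ F ∈ (R.shift p).body, Sat M v F) ↔
      (∀ F ∈ R.body, Sat M v F) ∧ ∀ a ∈ R.head, a.1 ∉ p → ¬Sat M v a.toFormula := by
    simp only [Rule.mem_body_shift, or_imp, forall_and]
    refine and_congr_right fun _ => ⟨fun h a ha hp => h _ ⟨a, ha, hp, rfl⟩, ?_⟩
    rintro h F ⟨a, ha, hp, rfl⟩
    exact h a ha hp
  simp only [hbody, Rule.mem_head_shift, and_assoc]

theorem Rule.satStar_shift {S : SymSet σ} (M : SInterp σ S) (u : PredAssign σ M.U)
    (p : Set σ.PredSym) (v : ℕ → M.U) (R : Rule σ) :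
    SatStar M u p v (R.shift p).toOpen ↔ SatStar M u p v R.toOpen := by
  rw [Rule.satStar_toOpen, Rule.satStar_toOpen, Rule.sat_shift,
    shift_imp_iff _ (∀ F ∈ R.body, _) (fun a => a.1 ∈ p)]
  have hbody : (∀ F ∈ (R.shift p).body, SatStar M u p v F) ↔
      (∀ F ∈ R.body, SatStar M u p v F) ∧
        ∀ a ∈ R.head, a.1 ∉ p → ¬SatStar M u p v a.toFormula := by
    simp only [Rule.mem_body_shift, or_imp, forall_and]
    refine and_congr_right fun _ =>
      ⟨fun h a ha hp => (PAtom.satStar_neg M u v hp).1 (h _ ⟨a, ha, hp, rfl⟩), ?_⟩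
    rintro h F ⟨a, ha, hp, rfl⟩
    exact (PAtom.satStar_neg M u v hp).2 (h a ha hp)
  simp only [hbody, Rule.mem_head_shift, and_assoc]

/-- **Observation 1.** For a traditional logic program `Pg`, the def-modules
`SM_p[Pg]` and `SM_p[shift_p(Pg)]` are equivalent (they have the same models). -/
theorem shift_equiv {σ : Signature} (Pg : Program σ) (p : Set σ.PredSym)
    (S : SymSet σ) (M : SInterp σ S) :
    Program.PStable p Pg M ↔ Program.PStable p (Program.shift p Pg) M := by
  simp only [Program.PStable, Program.shift, List.forall_mem_map, Rule.sat_shift,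
    Rule.satStar_shift]

end ASP
end

section
/- Let Π₁ and Π₂ be traditional logic programs such that π(Π₁) ⊆ π(Π₂), both programs share the same function symbols, and each contains at least one object constant. If SM_{π(Π₁)}[Π₁] and SM_{π(Π₂)}[Π₂] are equivalent to first-order formulas Π₁' and Π₂' respectively, and Π₂' is a conservative extension of Π₁', then the traditional program Π₂ is a conservative extension of Π₁, i.e., M ↦ M|σ(Π₁) is a 1-1 correspondence between the answer sets of Π₂ and the answer sets of Π₁. -/
namespace ASP

variable {σ : Signature}

/-- A class of models `MBig` (over symbols `SG`) is a *conservative extension* of a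
class of models `MSmall` (over symbols `SF`) if `M ↦ M|SF` is a 1-1 correspondence
between `MBig` and `MSmall`. -/
def ConsExt {SG SF : SymSet σ} (MBig : Set (SInterp σ SG)) (MSmall : Set (SInterp σ SF)) :
    Prop :=
  (∀ M ∈ MBig, M.restrict SF ∈ MSmall) ∧
  ∀ N ∈ MSmall, ∃! M : SInterp σ SG, M ∈ MBig ∧ M.restrict SF = N

/-- Ground terms formed from the function symbols (and object constants) in `Fs`. -/
inductive GTerm (σ : Signature) (Fs : Set σ.FunSym) : Type
  | fn (f : σ.FunSym) (hf : f ∈ Fs) (args : Fin (σ.funArity f) → GTerm σ Fs) : GTerm σ Fs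

theorem gterm_nonempty {Fs : Set σ.FunSym} (hc : ∃ f ∈ Fs, σ.funArity f = 0) :
    Nonempty (GTerm σ Fs) := by
  obtain ⟨f, hf, h0⟩ := hc
  exact ⟨GTerm.fn f hf (fun i => (Fin.cast h0 i).elim0)⟩

/-- Ground atoms over the symbol set `S`: a predicate symbol of `S` applied to
ground terms over the function symbols of `S`. -/
def HAtom (σ : Signature) (S : SymSet σ) :=
  {pa : Σ p : σ.PredSym, Fin (σ.predArity p) → GTerm σ S.funs // pa.1 ∈ S.preds}

open Classical in
/-- The Herbrand interpretation of the symbol set `S` determined by a set `X` of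
ground atoms: its universe is the set of ground terms over the function symbols of
`S`, function symbols are interpreted as term constructors, and the extension of the
predicates is given by `X`. -/
noncomputable def herbInterp (S : SymSet σ) (ne : Nonempty (GTerm σ S.funs))
    (X : Set (HAtom σ S)) : SInterp σ S where
  U := GTerm σ S.funs
  ne := ne
  funI f a := if hf : f ∈ S.funs then GTerm.fn f hf a else Classical.choice ne
  predI p a := ∃ hp : p ∈ S.preds, (⟨⟨p, a⟩, hp⟩ : HAtom σ S) ∈ X
  fun_default := by intro f hf a; simp [hf]
  pred_default := by
    intro p hp a
    simp only [eq_iff_iff, iff_false]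
    rintro ⟨h, _⟩; exact hp h

/-- `X` is an answer set of the program `Pg` (relative to the symbol set `S`): `X` is
a stable model (in the sense of Ferraris 2005, with every ground atom intensional) of
the grounding of `Pg`, where grounding replaces each rule by all its instances over
ground terms (here: all valuations into the Herbrand universe) and replaces each
ground equality `t₁ = t₂` by `⊤` if `t₁` and `t₂` are identical and by `⊥` otherwise
(here: equality evaluated in the Herbrand universe). -/
def IsAnswerSet (S : SymSet σ) (ne : Nonempty (GTerm σ S.funs)) (Pg : Program σ)
    (X : Set (HAtom σ S)) : Prop :=
  (∀ R ∈ Pg, ∀ v : ℕ → GTerm σ S.funs, Sat (herbInterp S ne X) v R.toOpen) ∧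
  ¬∃ Y : Set (HAtom σ S), Y ⊂ X ∧
    ∀ R ∈ Pg, ∀ v : ℕ → GTerm σ S.funs,
      SatStar (herbInterp S ne X)
        (fun p a => ∃ hp : p ∈ S.preds, (⟨⟨p, a⟩, hp⟩ : HAtom σ S) ∈ Y)
        Set.univ v R.toOpen

/-- The answer sets of a program, viewed as Herbrand interpretations of `σ(Pg)`. -/
def Program.AnswerModels (Pg : Program σ) : Set (SInterp σ Pg.syms) :=
  {M | ∃ (ne : Nonempty (GTerm σ Pg.syms.funs)) (X : Set (HAtom σ Pg.syms)),
        M = herbInterp Pg.syms ne X ∧ IsAnswerSet Pg.syms ne Pg X}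

/-- `M` is a Herbrand interpretation of its symbol set. -/
def SInterp.IsHerbrand {S : SymSet σ} (M : SInterp σ S) : Prop :=
  ∃ (ne : Nonempty (GTerm σ S.funs)) (X : Set (HAtom σ S)), M = herbInterp S ne X

/-- `F^*(u)` depends only on the intensional predicates occurring in `F` and on the values
of `u` at them. -/
theorem satStar_congr {S : SymSet σ} (M : SInterp σ S) {u u' : PredAssign σ M.U}
    {P P' : Set σ.PredSym} (F : Formula σ)
    (hP : ∀ p ∈ F.preds, p ∈ P ↔ p ∈ P') (hu : ∀ p ∈ F.preds, u p = u' p) (v : ℕ → M.U) :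
    SatStar M u P v F ↔ SatStar M u' P' v F := by
  induction F generalizing v with
  | falsum => rfl
  | pred p a => simp [SatStar, hP p rfl, hu p rfl]
  | eq t s => rfl
  | and F G ihF ihG | or F G ihF ihG | imp F G ihF ihG =>
    simp only [SatStar]
    rw [ihF (fun p hp => hP p (.inl hp)) (fun p hp => hu p (.inl hp)),
      ihG (fun p hp => hP p (.inr hp)) (fun p hp => hu p (.inr hp))]
  | all x F ih => exact forall_congr' fun d => ih hP hu _
  | ex x F ih => exact exists_congr fun d => ih hP hu _

/-- A Herbrand interpretation of `σ(Π)` is a model of `SM_{π(Π)}[Π]` iff the corresponding set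
of ground atoms is an answer set of `Π`. -/
theorem pstable_herbInterp_iff (Pg : Program σ) (ne : Nonempty (GTerm σ Pg.syms.funs))
    (X : Set (HAtom σ Pg.syms)) :
    Pg.PStable Pg.preds (herbInterp Pg.syms ne X) ↔ IsAnswerSet Pg.syms ne Pg X := by
  refine and_congr Iff.rfl (not_congr ⟨?_, ?_⟩)
  · rintro ⟨u, ⟨hle, hnot⟩, hu⟩
    refine ⟨{a | u a.1.1 a.1.2}, ⟨?_, ?_⟩, fun R hR v => ?_⟩
    · rintro ⟨⟨p, a⟩, hp⟩ h
      exact (hle p hp a h).2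
    · exact fun h => hnot fun p _ a ⟨_, hX⟩ => h hX
    · refine (satStar_congr (herbInterp Pg.syms ne X) (u := u) _ (fun p hp => ?_)
        (fun p hp => ?_) v).1 (hu R hR v)
      · exact iff_of_true ⟨R, hR, hp⟩ trivial
      · funext a
        exact propext ⟨fun h => ⟨⟨R, hR, hp⟩, h⟩, fun ⟨_, h⟩ => h⟩
  · rintro ⟨Y, ⟨hle, hnot⟩, hY⟩
    refine ⟨_, ⟨?_, ?_⟩, fun R hR v =>
      (satStar_congr _ _ (fun p hp => ?_) (fun _ _ => rfl) v).1 (hY R hR v)⟩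
    · exact fun p _ a ⟨hp, h⟩ => ⟨hp, hle h⟩
    · refine fun h => hnot ?_
      rintro ⟨⟨p, a⟩, hp⟩ hX
      exact (h p hp a ⟨hp, hX⟩).2
    · exact iff_of_true trivial ⟨R, hR, hp⟩

theorem mem_answerModels_iff (Pg : Program σ) (M : SInterp σ Pg.syms) :
    M ∈ Pg.AnswerModels ↔ M.IsHerbrand ∧ Pg.PStable Pg.preds M := by
  constructor
  · rintro ⟨ne, X, rfl, h⟩
    exact ⟨⟨ne, X, rfl⟩, (pstable_herbInterp_iff Pg ne X).2 h⟩
  · rintro ⟨⟨ne, X, rfl⟩, h⟩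
    exact ⟨ne, X, rfl, (pstable_herbInterp_iff Pg ne X).1 h⟩

/-- If two symbol sets share their function symbols, an interpretation is Herbrand iff its
restriction is. -/
theorem isHerbrand_restrict_iff {S T : SymSet σ} (hP : T.preds ⊆ S.preds)
    (hF : T.funs = S.funs) (M : SInterp σ S) :
    (M.restrict T).IsHerbrand ↔ M.IsHerbrand := by
  obtain ⟨P, F⟩ := S
  obtain ⟨Q, F'⟩ := T
  obtain rfl : F' = F := hF
  constructor
  · rintro ⟨ne, X, h⟩
    obtain ⟨U, neU, funI, predI, hfd, hpd⟩ := M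
    simp only [SInterp.restrict, herbInterp, SInterp.mk.injEq] at h
    obtain ⟨rfl, hf, -⟩ := h
    refine ⟨ne, {a | predI a.1.1 a.1.2}, ?_⟩
    simp only [herbInterp, SInterp.mk.injEq, heq_eq_eq, true_and]
    constructor
    · funext f a
      have := congrFun (congrFun (eq_of_heq hf) f) a
      by_cases hm : f ∈ F'
      · simpa [hm] using this
      · simpa [hm] using hfd f hm a
    · funext p a
      by_cases hp : p ∈ P
      · exact propext ⟨fun h => ⟨hp, h⟩, fun ⟨_, h⟩ => h⟩
      · simpa [hp] using hpd p hp a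
  · rintro ⟨ne, X, rfl⟩
    refine ⟨ne, {a | (⟨a.1, hP a.2⟩ : HAtom σ ⟨P, F'⟩) ∈ X}, ?_⟩
    unfold herbInterp SInterp.restrict
    congr 1
    · funext f a
      by_cases hm : f ∈ F' <;> simp [hm]
    · funext p a
      exact propext ⟨fun ⟨hq, _, h⟩ => ⟨hq, h⟩, fun ⟨hq, h⟩ => ⟨hq, hP hq, h⟩⟩

/-- **Proposition 2.** For traditional programs `Pg1` and `Pg2` such that
`π(Pg1) ⊆ π(Pg2)`, both programs share the same function symbols and contain at
least one object constant: if `SM_{π(Pg1)}[Pg1]` and `SM_{π(Pg2)}[Pg2]` are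
equivalent to first-order formulas `Pg1'` and `Pg2'` respectively, and `Pg2'` is a
conservative extension of `Pg1'`, then `Pg2` is a conservative extension of `Pg1`,
i.e. `M ↦ M|σ(Pg1)` is a 1-1 correspondence between the answer sets of `Pg2` and
the answer sets of `Pg1`. -/
theorem program_consExt_of_fo_consExt {σ : Signature} (Pg1 Pg2 : Program σ)
    (hπ : Program.preds Pg1 ⊆ Program.preds Pg2)
    (hfun : Program.funs Pg1 = Program.funs Pg2)
    (hc1 : ∃ f ∈ (Program.syms Pg1).funs, σ.funArity f = 0)
    (hc2 : ∃ f ∈ (Program.syms Pg2).funs, σ.funArity f = 0)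
    (Pg1' Pg2' : Formula σ)
    (hs1 : Formula.syms Pg1' = Program.syms Pg1)
    (hs2 : Formula.syms Pg2' = Program.syms Pg2)
    (heq1 : ∀ M : SInterp σ (Program.syms Pg1),
      Program.PStable (Program.preds Pg1) Pg1 M ↔ ∀ v, Sat M v Pg1')
    (heq2 : ∀ M : SInterp σ (Program.syms Pg2),
      Program.PStable (Program.preds Pg2) Pg2 M ↔ ∀ v, Sat M v Pg2')
    (hce : ConsExt {M : SInterp σ (Program.syms Pg2) | ∀ v, Sat M v Pg2'}
                   {M : SInterp σ (Program.syms Pg1) | ∀ v, Sat M v Pg1'}) :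
    ConsExt (Program.AnswerModels Pg2) (Program.AnswerModels Pg1) := by
  have key := fun M => isHerbrand_restrict_iff (S := Pg2.syms) (T := Pg1.syms) hπ hfun M
  have h1 := fun M => (mem_answerModels_iff Pg1 M).trans (and_congr_right' (heq1 M))
  have h2 := fun M => (mem_answerModels_iff Pg2 M).trans (and_congr_right' (heq2 M))
  refine ⟨fun M hM => ?_, fun N hN => ?_⟩
  · obtain ⟨hH, hS⟩ := (h2 M).1 hM
    exact (h1 _).2 ⟨(key M).2 hH, hce.1 M hS⟩
  · obtain ⟨hH, hS⟩ := (h1 N).1 hN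
    obtain ⟨M, ⟨hM, rfl⟩, huniq⟩ := hce.2 N hS
    exact ⟨M, ⟨(h2 M).2 ⟨(key M).1 hH, hM⟩, rfl⟩,
      fun M' ⟨hM', hr⟩ => huniq M' ⟨((h2 M').1 hM').2, hr⟩⟩

end ASP
end

section
/- Let SM_p[F] and SM_{p∪p'}[G] be def-modules such that π(F) ⊆ π(G), F and G share the same function symbols, and p' = π(G)\π(F). Then the following conditions are equivalent: (i) for every modular program P such that π(P) contains no elements of p', the modular program P ∪ {SM_{p∪p'}[G]} is a conservative extension of P ∪ {SM_p[F]}; (ii) SM_{p∪p'}[G] is a conservative extension of SM_p[F]. -/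
namespace ASP

variable {σ : Signature}

/-- A def-module `SM_p[F]`: a tuple `ip` of intensional predicate symbols together
with a traditional logic program `prog`. -/
structure DefModule (σ : Signature) where
  ip : Finset σ.PredSym
  prog : Program σ

/-- A first-order modular logic program: a finite set (list) of def-modules. -/
abbrev ModProgram (σ : Signature) := List (DefModule σ)

/-- `π(P)`: the predicate signature of a modular program. -/
def ModProgram.preds (P : ModProgram σ) : Set σ.PredSym := {p | ∃ D ∈ P, p ∈ D.prog.preds}

def ModProgram.funs (P : ModProgram σ) : Set σ.FunSym := {f | ∃ D ∈ P, f ∈ D.prog.funs}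

/-- `σ(P)`: the signature of a modular program. -/
def ModProgram.syms (P : ModProgram σ) : SymSet σ := ⟨P.preds, P.funs⟩

/-- `ι(P)`: the intensional signature of a modular program. -/
def ModProgram.iota (P : ModProgram σ) : Set σ.PredSym := {p | ∃ D ∈ P, p ∈ D.ip}

/-- `𝔉(P)`: the conjunction of the formulas of the def-modules of `P`. -/
def ModProgram.fml (P : ModProgram σ) : Program σ := (List.map DefModule.prog P).flatten

/-- `M` is a stable model of the modular program `P`: for every def-module
`SM_p[F]` in `P`, the restriction `M|σ(F)` is a `p`-stable model of `F`. -/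
def ModProgram.Stable {S : SymSet σ} (P : ModProgram σ) (M : SInterp σ S) : Prop :=
  ∀ D ∈ P, Program.PStable (↑D.ip) D.prog (M.restrict D.prog.syms)

/-- Predicate symbols occurring in the head of a rule. -/
def Rule.headPreds (R : Rule σ) : Set σ.PredSym := {p | ∃ a ∈ R.head, a.1 = p}

/-- Predicate symbols occurring in the positive part of the body of a rule. -/
def Rule.posPreds (R : Rule σ) : Set σ.PredSym :=
  {p | ∃ a ∈ R.pos, ∃ args, a = Atom.pred p args}

/-- A modular program is simple if in every def-module every predicate symbol
occurring in the head of a rule occurs in the intensional tuple. -/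
def ModProgram.Simple (P : ModProgram σ) : Prop :=
  ∀ D ∈ P, ∀ R ∈ D.prog, ∀ p ∈ R.headPreds, p ∈ D.ip

/-- The edges of the dependency graph `DG[P]`: the vertices are the members of
`ι(P)` and there is an edge from `p` to `q` if some def-module of `P` contains a rule
with `p` in the head and `q` in the positive part of the body. -/
def ModProgram.Edge (P : ModProgram σ) (p q : σ.PredSym) : Prop :=
  p ∈ P.iota ∧ q ∈ P.iota ∧
  ∃ D ∈ P, ∃ R ∈ D.prog, p ∈ R.headPreds ∧ q ∈ R.posPreds

/-- `c` is a strongly connected component of the dependency graph of `P`: a maximal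
nonempty set of vertices any two of which are reachable from each other. -/
def ModProgram.IsSCC (P : ModProgram σ) (c : Set σ.PredSym) : Prop :=
  c.Nonempty ∧ c ⊆ P.iota ∧
  (∀ a ∈ c, ∀ b ∈ c, Relation.ReflTransGen P.Edge a b) ∧
  ∀ c', c ⊆ c' → c' ⊆ P.iota →
    (∀ a ∈ c', ∀ b ∈ c', Relation.ReflTransGen P.Edge a b) → c' = c

/-- A simple modular program is coherent if (i) distinct def-modules have disjoint
intensional tuples, and (ii) every strongly connected component of its dependency
graph is contained in the intensional tuple of a single def-module. -/
def ModProgram.Coherent (P : ModProgram σ) : Prop :=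
  P.Simple ∧
  (∀ D ∈ P, ∀ D' ∈ P, D ≠ D' → ((↑D.ip ∩ ↑D'.ip : Set σ.PredSym) = ∅)) ∧
  (∀ c : Set σ.PredSym, P.IsSCC c → ∃ D ∈ P, c ⊆ ↑D.ip)

theorem SymSet.ext {S T : SymSet σ} (hp : S.preds = T.preds) (hf : S.funs = T.funs) :
    S = T := by
  cases S; cases T; simp_all

theorem SInterp.restrict_self {S : SymSet σ} (M : SInterp σ S) : M.restrict S = M := by
  obtain ⟨U, ne, f, p, hf, hp⟩ := M
  simp only [SInterp.restrict, SInterp.mk.injEq, heq_eq_eq, true_and]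
  constructor
  · funext g a
    by_cases hg : g ∈ S.funs
    · simp [hg]
    · simp [hg, hf g hg]
  · funext q a
    by_cases hq : q ∈ S.preds
    · simp [hq]
    · simp [hq, hp q hq]

theorem SInterp.restrict_restrict {S T T' : SymSet σ} (M : SInterp σ S)
    (hp : T.preds ⊆ T'.preds) (hf : T.funs ⊆ T'.funs) :
    (M.restrict T').restrict T = M.restrict T := by
  refine (SInterp.mk.injEq ..).mpr ⟨rfl, heq_of_eq ?_, heq_of_eq ?_⟩
  · funext g a
    by_cases hg : g ∈ T.funs
    · simp [SInterp.restrict, hg, hf hg]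
    · simp [SInterp.restrict, hg]
  · funext q a
    by_cases hq : q ∈ T.preds
    · simp [SInterp.restrict, hq, hp hq]
    · simp [SInterp.restrict, hq]

/-- Two interpretations that agree on the common symbols have a common expansion. -/
theorem SInterp.exists_amalgam {S₁ S₂ S T : SymSet σ} (M₁ : SInterp σ S₁) (M₂ : SInterp σ S₂)
    (hp : S.preds = S₁.preds ∪ S₂.preds) (hf : S.funs = S₁.funs ∪ S₂.funs)
    (hTp : S₁.preds ∩ S₂.preds ⊆ T.preds) (hTf : S₁.funs ∩ S₂.funs ⊆ T.funs)
    (h : M₁.restrict T = M₂.restrict T) :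
    ∃ M : SInterp σ S, M.restrict S₁ = M₁ ∧ M.restrict S₂ = M₂ := by
  classical
  obtain ⟨U, ne, f₁, p₁, hf₁, hp₁⟩ := M₁
  obtain ⟨U', ne', f₂, p₂, hf₂, hp₂⟩ := M₂
  simp only [SInterp.restrict, SInterp.mk.injEq] at h
  obtain ⟨rfl, hfe, hpe⟩ := h
  simp only [heq_eq_eq] at hfe hpe
  refine ⟨⟨U, ne, fun g => if g ∈ S₁.funs then f₁ g else f₂ g,
    fun q => if q ∈ S₁.preds then p₁ q else p₂ q, ?_, ?_⟩, ?_, ?_⟩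
  · intro g hg a
    rw [hf, Set.mem_union, not_or] at hg
    simp [hg.1, hf₂ g hg.2]
  · intro q hq a
    rw [hp, Set.mem_union, not_or] at hq
    simp [hq.1, hp₂ q hq.2]
  all_goals
    simp only [SInterp.restrict, SInterp.mk.injEq, heq_eq_eq, true_and]
    constructor
  · funext g a
    by_cases hg : g ∈ S₁.funs
    · simp [hg]
    · simp [hg, hf₁ g hg]
  · funext q a
    by_cases hq : q ∈ S₁.preds
    · simp [hq]
    · simp [hq, hp₁ q hq]
  · funext g a
    by_cases hg : g ∈ S₂.funs
    · by_cases hg' : g ∈ S₁.funs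
      · simpa [hg, hg', hTf ⟨hg', hg⟩] using congrFun (congrFun hfe g) a
      · simp [hg, hg']
    · simp [hg, hf₂ g hg]
  · funext q a
    by_cases hq : q ∈ S₂.preds
    · by_cases hq' : q ∈ S₁.preds
      · simpa [hq, hq', hTp ⟨hq', hq⟩] using congrFun (congrFun hpe q) a
      · simp [hq, hq']
    · simp [hq, hp₂ q hq]

/-- An interpretation is determined by its restrictions to two sets of symbols covering its
signature. -/
theorem SInterp.eq_of_restrict_eq {S₁ S₂ S : SymSet σ} {M N : SInterp σ S}
    (hp : S.preds ⊆ S₁.preds ∪ S₂.preds) (hf : S.funs ⊆ S₁.funs ∪ S₂.funs)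
    (h₁ : M.restrict S₁ = N.restrict S₁) (h₂ : M.restrict S₂ = N.restrict S₂) : M = N := by
  obtain ⟨U, ne, f, p, hfd, hpd⟩ := M
  obtain ⟨U', ne', f', p', hfd', hpd'⟩ := N
  simp only [SInterp.restrict, SInterp.mk.injEq] at h₁ h₂
  obtain ⟨rfl, hf₁, hp₁⟩ := h₁
  obtain ⟨-, hf₂, hp₂⟩ := h₂
  simp only [heq_eq_eq] at hf₁ hp₁ hf₂ hp₂
  simp only [SInterp.mk.injEq, heq_eq_eq, true_and]
  constructor
  · funext g a
    by_cases hg : g ∈ S.funs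
    · rcases hf hg with hg' | hg'
      · simpa [hg'] using congrFun (congrFun hf₁ g) a
      · simpa [hg'] using congrFun (congrFun hf₂ g) a
    · rw [hfd g hg, hfd' g hg]
  · funext q a
    by_cases hq : q ∈ S.preds
    · rcases hp hq with hq' | hq'
      · simpa [hq'] using congrFun (congrFun hp₁ q) a
      · simpa [hq'] using congrFun (congrFun hp₂ q) a
    · rw [hpd q hq, hpd' q hq]

theorem ModProgram.preds_cons (D : DefModule σ) (P : ModProgram σ) :
    ModProgram.preds (D :: P) = D.prog.preds ∪ P.preds := by
  ext q; simp [ModProgram.preds]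

theorem ModProgram.funs_cons (D : DefModule σ) (P : ModProgram σ) :
    ModProgram.funs (D :: P) = D.prog.funs ∪ P.funs := by
  ext g; simp [ModProgram.funs]

theorem ModProgram.syms_singleton (D : DefModule σ) : ModProgram.syms [D] = D.prog.syms :=
  SymSet.ext (by simp [ModProgram.syms, ModProgram.preds, Program.syms])
    (by simp [ModProgram.syms, ModProgram.funs, Program.syms])

theorem ModProgram.stable_singleton {S : SymSet σ} (D : DefModule σ) (M : SInterp σ S) :
    ModProgram.Stable [D] M ↔ Program.PStable ↑D.ip D.prog (M.restrict D.prog.syms) := by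
  simp [ModProgram.Stable]

/-- Stability only depends on the symbols occurring in the modular program. -/
theorem ModProgram.stable_restrict {S T : SymSet σ} {P : ModProgram σ} {M : SInterp σ S}
    (hp : P.preds ⊆ T.preds) (hf : P.funs ⊆ T.funs) :
    P.Stable (M.restrict T) ↔ P.Stable M := by
  refine forall₂_congr fun D hD => ?_
  rw [SInterp.restrict_restrict]
  · exact fun q hq => hp ⟨D, hD, hq⟩
  · exact fun g hg => hf ⟨D, hD, hg⟩

theorem ModProgram.stable_cons {S : SymSet σ} {D : DefModule σ} {P : ModProgram σ}
    {M : SInterp σ S} :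
    ModProgram.Stable (D :: P) M ↔
      Program.PStable ↑D.ip D.prog (M.restrict D.prog.syms) ∧ P.Stable M := by
  simp [ModProgram.Stable]

open Classical in
/-- **Theorem 4.** Let `SM_p[F]` and `SM_{p∪p'}[G]` be def-modules such that
`π(F) ⊆ π(G)`, both programs share the same function symbols, and
`p' = π(G)∖π(F)`. The following are equivalent: (i) for any modular program `P`
such that `π(P)` contains no elements of `p'`, the modular program
`P ∪ {SM_{p∪p'}[G]}` is a conservative extension of `P ∪ {SM_p[F]}`;
(ii) `SM_{p∪p'}[G]` is a conservative extension of `SM_p[F]`. -/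
theorem strong_consExt_defmodules {σ : Signature} (F G : Program σ)
    (p p' : Finset σ.PredSym)
    (hπ : Program.preds F ⊆ Program.preds G)
    (hfun : Program.funs F = Program.funs G)
    (hp' : (↑p' : Set σ.PredSym) = Program.preds G \ Program.preds F) :
    (∀ P : ModProgram σ, (∀ q ∈ p', q ∉ ModProgram.preds P) →
        ConsExt
          {M : SInterp σ (ModProgram.syms (⟨p ∪ p', G⟩ :: P)) |
            ModProgram.Stable (⟨p ∪ p', G⟩ :: P) M}
          {M : SInterp σ (ModProgram.syms (⟨p, F⟩ :: P)) |
            ModProgram.Stable (⟨p, F⟩ :: P) M}) ↔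
    ConsExt {M : SInterp σ (Program.syms G) | Program.PStable (↑(p ∪ p')) G M}
            {M : SInterp σ (Program.syms F) | Program.PStable (↑p) F M} := by
  constructor
  · intro h
    have h := h [] (by simp [ModProgram.preds])
    simp only [ModProgram.stable_singleton] at h
    rw [ModProgram.syms_singleton, ModProgram.syms_singleton] at h
    simpa only [SInterp.restrict_self] using h
  · rintro ⟨hmap, hex⟩ P hP
    have hGp : Program.preds G ∩ P.preds ⊆ Program.preds F := fun q hq => by
      by_contra hqF
      have hq' : q ∈ (↑p' : Set σ.PredSym) := hp' ▸ ⟨hq.1, hqF⟩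
      exact hP q hq' hq.2
    set SGP := ModProgram.syms (⟨p ∪ p', G⟩ :: P)
    set SFP := ModProgram.syms (⟨p, F⟩ :: P)
    have hGPp : SGP.preds = Program.preds G ∪ P.preds := ModProgram.preds_cons _ _
    have hGPf : SGP.funs = Program.funs G ∪ P.funs := ModProgram.funs_cons _ _
    have hFPp : SFP.preds = Program.preds F ∪ P.preds := ModProgram.preds_cons _ _
    have hFPf : SFP.funs = Program.funs F ∪ P.funs := ModProgram.funs_cons _ _
    have hcovp : SGP.preds = (Program.syms G).preds ∪ SFP.preds := by
      rw [hGPp, hFPp, ← Set.union_assoc]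
      exact congrArg (· ∪ _) (Set.union_eq_left.2 hπ).symm
    have hcovf : SGP.funs = (Program.syms G).funs ∪ SFP.funs := by
      rw [hGPf, hFPf, ← Set.union_assoc]
      exact congrArg (· ∪ _) (Set.union_eq_left.2 hfun.le).symm
    have hresG (M : SInterp σ SGP) :
        (M.restrict (Program.syms G)).restrict (Program.syms F) = M.restrict (Program.syms F) :=
      SInterp.restrict_restrict _ hπ hfun.le
    have hresF (M : SInterp σ SGP) :
        (M.restrict SFP).restrict (Program.syms F) = M.restrict (Program.syms F) :=
      SInterp.restrict_restrict _ (hFPp ▸ Set.subset_union_left) (hFPf ▸ Set.subset_union_left)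
    have hresP (M : SInterp σ SGP) : P.Stable (M.restrict SFP) ↔ P.Stable M :=
      ModProgram.stable_restrict (hFPp ▸ Set.subset_union_right) (hFPf ▸ Set.subset_union_right)
    refine ⟨fun M hM => ?_, fun N hN => ?_⟩
    · obtain ⟨hMG, hMP⟩ := ModProgram.stable_cons.1 hM
      refine ModProgram.stable_cons.2 ⟨?_, (hresP M).2 hMP⟩
      have := hmap _ hMG
      rw [hresG] at this
      rw [hresF]
      exact this
    · obtain ⟨hNF, hNP⟩ := ModProgram.stable_cons.1 hN
      obtain ⟨K, ⟨hK, hKN⟩, huniq⟩ := hex _ hNF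
      obtain ⟨M, hMK, hMN⟩ := SInterp.exists_amalgam (T := Program.syms F) K N hcovp hcovf
        (by
          rw [hFPp, Set.inter_union_distrib_left]
          exact Set.union_subset Set.inter_subset_right hGp)
        (fun g hg => hfun.ge hg.1) hKN
      refine ⟨M, ⟨ModProgram.stable_cons.2 ⟨?_, ?_⟩, hMN⟩, ?_⟩
      · rw [hMK]
        exact hK
      · rw [← hresP, hMN]
        exact hNP
      · rintro M' ⟨hM', hM'N⟩
        refine SInterp.eq_of_restrict_eq hcovp.le hcovf.le ?_ (hM'N.trans hMN.symm)
        rw [hMK]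
        refine huniq _ ⟨(ModProgram.stable_cons.1 hM').1, ?_⟩
        rw [hresG, ← hresF, hM'N]

end ASP
end

section
/- The def-module SM_{p,p̂}[(¬p̂ → p) ∧ (¬p → p̂)], where p and p̂ are propositional atoms (0-ary predicate symbols), is a conservative extension of the def-module SM_p[p ∨ ¬p]. -/
namespace ASP

variable {σ : Signature}

/-- The propositional atoms `p` and `p̂` (0-ary predicate symbols). -/
inductive PS14 : Type | p | ph

/-- The signature with the propositional atoms `p`, `p̂` and no function symbols. -/
def σ14 : Signature where
  PredSym := PS14
  FunSym := Empty
  predArity := fun _ => 0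
  funArity := fun f => f.elim

/-- The formula `p ∨ ¬p`. -/
def F14 : Formula σ14 := .or (.pred PS14.p ![]) (Formula.neg (.pred PS14.p ![]))

/-- The formula `(¬p̂ → p) ∧ (¬p → p̂)`. -/
def G14 : Formula σ14 :=
  .and (.imp (Formula.neg (.pred PS14.ph ![])) (.pred PS14.p ![]))
       (.imp (Formula.neg (.pred PS14.p ![])) (.pred PS14.ph ![]))

instance (U : Type) (q : σ14.PredSym) : Unique (Fin (σ14.predArity q) → U) :=
  inferInstanceAs (Unique (Fin 0 → U))

/-- The truth value of a propositional atom. -/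
def SInterp.holds {S : SymSet σ14} (M : SInterp σ14 S) (q : σ14.PredSym) : Prop :=
  M.predI q default

theorem SInterp.predI_iff_holds {S : SymSet σ14} (M : SInterp σ14 S) (q : σ14.PredSym)
    (a : Fin (σ14.predArity q) → M.U) : M.predI q a ↔ M.holds q := by
  rw [Subsingleton.elim a default]; rfl

/-- The truth value a tuple of predicate variables assigns to a propositional atom. -/
def PredAssign.holds {U : Type} (u : PredAssign σ14 U) (q : σ14.PredSym) : Prop :=
  u q default

theorem sat_pred {S : SymSet σ14} (M : SInterp σ14 S) (v : ℕ → M.U) (q : σ14.PredSym)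
    (a : Fin (σ14.predArity q) → Term σ14) : Sat M v (.pred q a) ↔ M.holds q :=
  M.predI_iff_holds q _

theorem satStar_pred {S : SymSet σ14} (M : SInterp σ14 S) (u : PredAssign σ14 M.U)
    {P : Set σ14.PredSym} (v : ℕ → M.U) {q : σ14.PredSym} (hq : q ∈ P)
    (a : Fin (σ14.predArity q) → Term σ14) : SatStar M u P v (.pred q a) ↔ u.holds q := by
  simp only [SatStar, hq, true_and, not_true_eq_false, false_and, or_false]
  rw [Subsingleton.elim (fun i => (a i).eval M v) default]
  rfl

theorem uLt_iff {S : SymSet σ14} (M : SInterp σ14 S) (P : Set σ14.PredSym)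
    (u : PredAssign σ14 M.U) :
    uLt M P u ↔ (∀ q ∈ P, u.holds q → M.holds q) ∧ ¬ ∀ q ∈ P, M.holds q → u.holds q := by
  simp only [uLt, Unique.forall_iff, SInterp.holds, PredAssign.holds]

/-- Every interpretation is a stable model of the choice formula `p ∨ ¬p`. -/
theorem pStable_F14 {S : SymSet σ14} (M : SInterp σ14 S) :
    Formula.PStable ({PS14.p} : Set σ14.PredSym) F14 M := by
  refine ⟨fun v => em _, ?_⟩
  rintro ⟨u, hlt, hs⟩
  rw [uLt_iff] at hlt
  obtain ⟨x⟩ := M.ne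
  apply hlt.2
  rintro q rfl hq
  rcases hs (fun _ => x) with h | h
  · exact (satStar_pred M u _ rfl _).1 h
  · exact (h.2 ((sat_pred M _ _ _).2 hq)).elim

theorem sat_G14_iff {S : SymSet σ14} (M : SInterp σ14 S) (v : ℕ → M.U) :
    Sat M v G14 ↔ M.holds PS14.p ∨ M.holds PS14.ph := by
  have hp := sat_pred M v PS14.p ![]
  have hph := sat_pred M v PS14.ph ![]
  simp only [G14, Formula.neg, Sat] at hp hph ⊢
  tauto

theorem satStar_G14_iff {S : SymSet σ14} (M : SInterp σ14 S) (u : PredAssign σ14 M.U)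
    (hu : ∀ q, u.holds q → M.holds q) (v : ℕ → M.U) :
    SatStar M u ({PS14.p, PS14.ph} : Set σ14.PredSym) v G14 ↔
      (M.holds PS14.p ∨ M.holds PS14.ph) ∧ (¬ M.holds PS14.ph → u.holds PS14.p) ∧
        (¬ M.holds PS14.p → u.holds PS14.ph) := by
  have hup := hu PS14.p
  have huph := hu PS14.ph
  have hp := sat_pred M v PS14.p ![]
  have hph := sat_pred M v PS14.ph ![]
  have hsp := satStar_pred M u (P := {PS14.p, PS14.ph}) v (Or.inl rfl : PS14.p ∈ _) ![]
  have hsph := satStar_pred M u (P := {PS14.p, PS14.ph}) v (Or.inr rfl : PS14.ph ∈ _) ![]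
  simp only [G14, Formula.neg, SatStar, Sat] at hp hph hsp hsph ⊢
  rw [hsp, hsph, hp, hph]
  clear hp hph hsp hsph hu
  tauto

/-- The stable models of `(¬p̂ → p) ∧ (¬p → p̂)` are those in which exactly one of
`p`, `p̂` holds. -/
theorem pStable_G14_iff {S : SymSet σ14} (M : SInterp σ14 S) :
    Formula.PStable ({PS14.p, PS14.ph} : Set σ14.PredSym) G14 M ↔
      (M.holds PS14.ph ↔ ¬ M.holds PS14.p) := by
  obtain ⟨x⟩ := M.ne
  have key : ∀ u : PredAssign σ14 M.U,
      (uLt M ({PS14.p, PS14.ph} : Set σ14.PredSym) u ∧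
        ∀ v, SatStar M u ({PS14.p, PS14.ph} : Set σ14.PredSym) v G14) ↔
      ((u.holds PS14.p → M.holds PS14.p) ∧ (u.holds PS14.ph → M.holds PS14.ph)) ∧
        ¬ ((M.holds PS14.p → u.holds PS14.p) ∧ (M.holds PS14.ph → u.holds PS14.ph)) ∧
        (M.holds PS14.p ∨ M.holds PS14.ph) ∧ (¬ M.holds PS14.ph → u.holds PS14.p) ∧
        (¬ M.holds PS14.p → u.holds PS14.ph) := by
    intro u
    have hall : ∀ C : σ14.PredSym → Prop,
        (∀ q ∈ ({PS14.p, PS14.ph} : Set σ14.PredSym), C q) ↔ C PS14.p ∧ C PS14.ph :=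
      fun C => ⟨fun h => ⟨h _ (Or.inl rfl), h _ (Or.inr rfl)⟩,
        fun h q _ => match q with | .p => h.1 | .ph => h.2⟩
    rw [uLt_iff, hall, hall, and_assoc]
    refine and_congr_right fun hu => and_congr_right fun _ => ?_
    have hu' : ∀ q, u.holds q → M.holds q :=
      fun q => match q with | .p => hu.1 | .ph => hu.2
    simp only [satStar_G14_iff M u hu']
    exact ⟨fun h => h fun _ => x, fun h _ => h⟩
  simp only [Formula.PStable, sat_G14_iff, key]
  constructor
  · rintro ⟨hs, hn⟩
    have hs := hs fun _ => x
    by_contra hne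
    refine hn ⟨fun _ _ => False, ?_⟩
    simp only [PredAssign.holds]
    tauto
  · intro h
    refine ⟨fun _ => by tauto, ?_⟩
    rintro ⟨u, hu⟩
    tauto

theorem SInterp.mk_eq_mk {S : SymSet σ} {U : Type} {ne : Nonempty U}
    {f f' : (g : σ.FunSym) → (Fin (σ.funArity g) → U) → U}
    {r r' : (q : σ.PredSym) → (Fin (σ.predArity q) → U) → Prop}
    {fd : ∀ g ∉ S.funs, ∀ a, f g a = Classical.choice ne}
    {fd' : ∀ g ∉ S.funs, ∀ a, f' g a = Classical.choice ne}
    {rd : ∀ q ∉ S.preds, ∀ a, r q a = False} {rd' : ∀ q ∉ S.preds, ∀ a, r' q a = False}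
    (hf : f = f') (hr : r = r') :
    (⟨U, ne, f, r, fd, rd⟩ : SInterp σ S) = ⟨U, ne, f', r', fd', rd'⟩ := by
  subst hf hr
  rfl

theorem p_mem_F14_preds : (PS14.p : σ14.PredSym) ∈ F14.syms.preds := Or.inl rfl

theorem ph_notMem_F14_preds : (PS14.ph : σ14.PredSym) ∉ F14.syms.preds := by
  rintro (h | h | h) <;> cases h

theorem mem_G14_preds (q : σ14.PredSym) : q ∈ G14.syms.preds :=
  match q with
  | .p => Or.inl (Or.inr rfl)
  | .ph => Or.inl (Or.inl (Or.inl rfl))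

/-- The extension of an interpretation of `p` that makes `p̂` the complement of `p`. -/
def SInterp.extendCompl (N : SInterp σ14 F14.syms) : SInterp σ14 G14.syms where
  U := N.U
  ne := N.ne
  funI f := f.elim
  predI
    | PS14.p, _ => N.holds PS14.p
    | PS14.ph, _ => ¬ N.holds PS14.p
  fun_default f := f.elim
  pred_default q hq := absurd (mem_G14_preds q) hq

theorem SInterp.extendCompl_restrict (N : SInterp σ14 F14.syms) :
    N.extendCompl.restrict F14.syms = N := by
  have hp := N.predI_iff_holds PS14.p
  rcases N with ⟨U, ne, fI, pI, fd, pd⟩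
  refine SInterp.mk_eq_mk (funext fun f => f.elim)
    (funext fun q => funext fun a => propext ?_)
  cases q with
  | p => exact (and_iff_right p_mem_F14_preds).trans (hp a).symm
  | ph =>
    exact iff_of_false (fun h => ph_notMem_F14_preds (And.left h))
      (pd PS14.ph ph_notMem_F14_preds a).mp

theorem SInterp.eq_extendCompl (M : SInterp σ14 G14.syms)
    (h : M.holds PS14.ph ↔ ¬ M.holds PS14.p) :
    M = (M.restrict F14.syms).extendCompl := by
  have hp := M.predI_iff_holds PS14.p
  have hph := M.predI_iff_holds PS14.ph
  rcases M with ⟨U, ne, fI, pI, fd, pd⟩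
  refine SInterp.mk_eq_mk (funext fun f => f.elim)
    (funext fun q => funext fun a => propext ?_)
  cases q with
  | p => exact (hp a).trans (and_iff_right p_mem_F14_preds).symm
  | ph => exact (hph a).trans (h.trans (not_congr (and_iff_right p_mem_F14_preds).symm))

/-- **Example.** The def-module `SM_{p,p̂}[(¬p̂ → p) ∧ (¬p → p̂)]` is a conservative
extension of the def-module `SM_p[p ∨ ¬p]`. -/
theorem choice_consExt :
    ConsExt
      {M : SInterp σ14 G14.syms | Formula.PStable ({PS14.p, PS14.ph} : Set σ14.PredSym) G14 M}
      {M : SInterp σ14 F14.syms | Formula.PStable ({PS14.p} : Set σ14.PredSym) F14 M} := by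
  refine ⟨fun M _ => pStable_F14 _, fun N _ => ⟨N.extendCompl, ⟨?_, N.extendCompl_restrict⟩, ?_⟩⟩
  · exact (pStable_G14_iff _).2 Iff.rfl
  · rintro M ⟨hM, rfl⟩
    exact M.eq_extendCompl ((pStable_G14_iff M).1 hM)

end ASP
end
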